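/- Define L' : ℕ → ℝ by L'(0) = 1/2, L'(1) = 0, and L'(n) = DI(n) (regarded as a real number) for all n ≥ 2. Then L' is an injective sequence of real numbers in [0,1), and the antidiagonal real ∑_{n=0}^∞ (1 − d_{n+1}(L'(n)))·2^{−(n+1)} is equal to 1/2 = L'(0); hence the diagonal method applied to this shuffled enumeration of all finitely-writable binary fractions yields a number already in the list. -/

import Mathlib

/-- The `k`-th canonical binary digit of a real `x`: `⌊x·2^k⌋ mod 2`. -/
noncomputable def binDigit (k : ℕ) (x : ℝ) : ℤ := ⌊x * 2 ^ k⌋ % 2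

/-- The digit-reversal map: `DI(n) = ∑_i bit_i(n)·2^{-(i+1)}`, where
`bit_i(n) = ⌊n/2^i⌋ mod 2` (all bits with index `i ≥ n` vanish). -/
def DI (n : ℕ) : ℚ := ∑ i ∈ Finset.range n, ((n / 2 ^ i % 2 : ℕ) : ℚ) / 2 ^ (i + 1)

/-- The shuffled list: `L'(0) = 1/2`, `L'(1) = 0`, and `L'(n) = DI(n)` for `n ≥ 2`. -/
noncomputable def L' : ℕ → ℝ
  | 0 => 1 / 2
  | 1 => 0
  | n + 2 => ((DI (n + 2) : ℚ) : ℝ)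

theorem DI_ext (n k : ℕ) : ∑ i ∈ Finset.range (n + k), ((n / 2 ^ i % 2 : ℕ) : ℚ) / 2 ^ (i + 1) = DI n := by
  induction k with
  | zero => rfl
  | succ k ih =>
    rw [← add_assoc, Finset.sum_range_succ, ih]
    have h : n / 2 ^ (n + k) = 0 := Nat.div_eq_of_lt
      (lt_of_lt_of_le Nat.lt_two_pow_self (Nat.pow_le_pow_right (by norm_num) (by omega)))
    simp [h]

theorem DI_rec (n : ℕ) : DI n = (((n % 2 : ℕ) : ℚ) + DI (n / 2)) / 2 := by
  rw [← DI_ext n 1, Finset.sum_range_succ']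
  have h := DI_ext (n / 2) (n - n / 2)
  rw [Nat.add_sub_cancel' (Nat.div_le_self n 2)] at h
  rw [← h, add_div, Finset.sum_div, add_comm]
  congr 1
  · simp
  · apply Finset.sum_congr rfl
    intro i _
    rw [Nat.div_div_eq_div_mul, ← pow_succ', pow_succ (2 : ℚ) (i + 1), div_div]

theorem DI_zero : DI 0 = 0 := by simp [DI]

theorem DI_one : DI 1 = 1 / 2 := by simp [DI]

theorem DI_bound (N : ℕ) : ∀ n ≤ N, 0 ≤ DI n ∧ DI n < 1 := by
  induction N with
  | zero =>
    intro n hn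
    obtain rfl : n = 0 := by omega
    simp [DI_zero]
  | succ N ih =>
    intro n hn
    obtain ⟨h0, h1⟩ := ih (n / 2) (by omega)
    rw [DI_rec]
    rcases Nat.mod_two_eq_zero_or_one n with h | h <;> rw [h] <;> push_cast <;>
      constructor <;> linarith

theorem DI_inj (N : ℕ) : ∀ a ≤ N, ∀ b ≤ N, DI a = DI b → a = b := by
  induction N with
  | zero => intro a ha b hb _; omega
  | succ N ih =>
    intro a ha b hb h
    obtain ⟨a0, a1⟩ := DI_bound _ (a / 2) le_rfl
    obtain ⟨b0, b1⟩ := DI_bound _ (b / 2) le_rfl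
    have key := ih (a / 2) (by omega) (b / 2) (by omega)
    rw [DI_rec a, DI_rec b] at h
    rcases Nat.mod_two_eq_zero_or_one a with h2 | h2 <;>
      rcases Nat.mod_two_eq_zero_or_one b with h3 | h3 <;> rw [h2, h3] at h <;> push_cast at h
    · have := key (by linarith); omega
    · exfalso; linarith
    · exfalso; linarith
    · have := key (by linarith); omega

theorem DI_int (n k : ℕ) : ∃ m : ℤ,
    (∑ i ∈ Finset.range k, ((n / 2 ^ i % 2 : ℕ) : ℚ) / 2 ^ (i + 1)) * 2 ^ k = m := by
  induction k with
  | zero => exact ⟨0, by simp⟩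
  | succ k ih =>
    obtain ⟨m, hm⟩ := ih
    refine ⟨2 * m + ((n / 2 ^ k % 2 : ℕ) : ℤ), ?_⟩
    rw [Finset.sum_range_succ, add_mul, div_mul_cancel₀ _ (by positivity), pow_succ, ← mul_assoc, hm,
      Int.cast_add, Int.cast_natCast, Int.cast_mul, Int.cast_ofNat, mul_comm (m : ℚ)]

theorem L'_eq (n : ℕ) : L' n = ((DI (Equiv.swap 0 1 n) : ℚ) : ℝ) := by
  match n with
  | 0 => simp [L', DI_one]
  | 1 => simp [L', DI_zero]
  | n + 2 => rw [Equiv.swap_apply_of_ne_of_ne (by omega) (by omega)]; rfl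

theorem dig_zero : binDigit 1 (L' 0) = 1 := by
  simp [binDigit, L']

theorem dig_succ (n : ℕ) : binDigit (n + 1 + 1) (L' (n + 1)) = 0 := by
  match n with
  | 0 => simp [binDigit, L']
  | n + 1 =>
    obtain ⟨m, hm⟩ := DI_int (n + 2) (n + 2)
    change DI (n + 2) * 2 ^ (n + 2) = m at hm
    have hm' : ((DI (n + 2) : ℚ) : ℝ) * 2 ^ (n + 2) = m := by exact_mod_cast hm
    have : L' (n + 1 + 1) * 2 ^ (n + 1 + 1 + 1) = ((m * 2 : ℤ) : ℝ) := by
      change ((DI (n + 2) : ℚ) : ℝ) * 2 ^ (n + 2 + 1) = _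
      rw [pow_succ, ← mul_assoc, hm']
      push_cast
      rfl
    rw [binDigit, this, Int.floor_intCast]
    omega

theorem diag_sum : (∑' n : ℕ, (1 - (binDigit (n + 1) (L' n) : ℝ)) / 2 ^ (n + 1)) = 1 / 2 := by
  apply HasSum.tsum_eq
  rw [← hasSum_nat_add_iff' 1]
  simp only [Finset.sum_range_one, zero_add, dig_zero, dig_succ]
  have h := (hasSum_geometric_two).mul_left (1 / 4 : ℝ)
  convert h using 1
  · rfl
  · funext n
    rw [one_div_pow]
    push_cast
    field_simp
    ring
  · norm_num

theorem stmt_6 :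
    Function.Injective L' ∧
    (∀ n : ℕ, 0 ≤ L' n ∧ L' n < 1) ∧
    (∑' n : ℕ, (1 - (binDigit (n + 1) (L' n) : ℝ)) / 2 ^ (n + 1)) = 1 / 2 ∧
    (∑' n : ℕ, (1 - (binDigit (n + 1) (L' n) : ℝ)) / 2 ^ (n + 1)) = L' 0 := by
  refine ⟨?_, ?_, diag_sum, ?_⟩
  · intro a b h
    rw [L'_eq, L'_eq] at h
    have h2 := DI_inj _ _ (le_max_left _ _) _ (le_max_right _ _) (Rat.cast_injective h)
    exact (Equiv.swap 0 1).injective h2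
  · intro n
    rw [L'_eq]
    obtain ⟨h0, h1⟩ := DI_bound _ (Equiv.swap 0 1 n) le_rfl
    exact ⟨by exact_mod_cast h0, by exact_mod_cast h1⟩
  · rw [diag_sum]; rfl
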